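/- arXiv:2103.15874 — 3 statements merged into one kernel-verified Lean document; each statement's English description precedes it below -/
import Mathlib

section
/- Let α: ℝ → ℝ be a locally Lipschitz, strictly increasing function with α(0) = 0, and let h: ℝ → ℝ be differentiable with h(0) ≥ 0 and h'(t) + α(h(t)) ≥ 0 for all t ≥ 0. Then h(t) ≥ 0 for all t ≥ 0. -/
/-- Scalar comparison lemma underlying control barrier functions (m = 1 case of
HOCBF forward-invariance, stated along a trajectory): if `α : ℝ → ℝ` is a locally
Lipschitz, strictly increasing function with `α 0 = 0` (a class-K function extended
to ℝ), `h : ℝ → ℝ` is differentiable, `h 0 ≥ 0`, and `h' t + α (h t) ≥ 0` for all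
`t ≥ 0`, then `h t ≥ 0` for all `t ≥ 0`. -/
theorem cbf_scalar_comparison
    (α h : ℝ → ℝ)
    (hα_lip : LocallyLipschitz α) (hα_mono : StrictMono α) (hα0 : α 0 = 0)
    (hdiff : Differentiable ℝ h) (h0 : h 0 ≥ 0)
    (hineq : ∀ t, 0 ≤ t → deriv h t + α (h t) ≥ 0) :
    ∀ t, 0 ≤ t → h t ≥ 0 := by
  intro t ht
  suffices -h t ≤ 0 by linarith
  refine le_of_forall_pos_le_add fun ε hε => ?_
  rw [zero_add]
  refine image_le_of_deriv_right_lt_deriv_boundary (f := fun s => -h s) (f' := fun s => -deriv h s)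
    (B := fun _ => ε) (B' := fun _ => 0) (a := 0) (b := t) hdiff.continuous.neg.continuousOn
    (fun s _ => (hdiff s).hasDerivAt.neg.hasDerivWithinAt) (by linarith)
    (fun s => hasDerivAt_const s ε) (fun s hs hsε => ?_) ⟨ht, le_rfl⟩
  have hα_neg : α (h s) < 0 := hα0 ▸ hα_mono (by linarith : h s < 0)
  linarith [hineq s hs.1]
end

section
/- Let m ≥ 1, let α₁, …, α_m: ℝ → ℝ be locally Lipschitz, strictly increasing functions with α_i(0) = 0, and let ψ₀, …, ψ_{m-1}: ℝ → ℝ be differentiable functions satisfying the recursion ψ_i(t) = ψ_{i-1}'(t) + α_i(ψ_{i-1}(t)) for all t ≥ 0 and all i ∈ {1, …, m−1}. If ψ_i(0) ≥ 0 for every i ∈ {0, …, m−1}, and ψ_{m-1}'(t) + α_m(ψ_{m-1}(t)) ≥ 0 for all t ≥ 0, then ψ_i(t) ≥ 0 for every i ∈ {0, …, m−1} and all t ≥ 0. -/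
/-- If `y` is differentiable with `y 0 ≥ 0` and `y' + α ∘ y ≥ 0` on `[0, ∞)`, where `α` is
negative on the negative reals, then `y` is nonnegative on `[0, ∞)`. -/
theorem nonneg_of_deriv_add_comp_nonneg {α y : ℝ → ℝ} (hα : ∀ x, x < 0 → α x < 0)
    (hy : Differentiable ℝ y) (hy0 : 0 ≤ y 0)
    (h : ∀ t, 0 ≤ t → 0 ≤ deriv y t + α (y t)) {t : ℝ} (ht : 0 ≤ t) : 0 ≤ y t := by
  refine le_of_forall_pos_le_add fun ε hε => ?_
  have hle : -y t ≤ ε := by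
    refine image_le_of_deriv_right_lt_deriv_boundary (f := fun s => -y s)
      (f' := fun s => -deriv y s) (B := fun _ => ε) (B' := fun _ => 0) (a := 0) (b := t)
      hy.continuous.neg.continuousOn
      (fun s _ => (hy s).hasDerivAt.neg.hasDerivWithinAt) (by linarith)
      (fun s => hasDerivAt_const s ε) (fun s hs hsε => ?_) ⟨ht, le_rfl⟩
    have hneg : α (y s) < 0 := hα _ (by linarith)
    linarith [h s hs.1]
  linarith

/-- HOCBF forward invariance along a trajectory (paper's Theorem 1, stated for the
sequence of functions `ψ₀, …, ψ_{m-1}` built via the recursion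
`ψ i = ψ (i-1)' + α i ∘ ψ (i-1)`): if each `α i` (for `1 ≤ i ≤ m`) is a locally
Lipschitz, strictly increasing function vanishing at `0` (class-K extended to ℝ),
each `ψ i` (for `i ≤ m - 1`) is differentiable and nonnegative at time `0`, the
recursion holds for `1 ≤ i ≤ m - 1` on `t ≥ 0`, and the final constraint
`ψ (m-1)' t + α m (ψ (m-1) t) ≥ 0` holds for all `t ≥ 0`, then every `ψ i`
(for `i ≤ m - 1`) remains nonnegative for all `t ≥ 0`. -/
theorem hocbf_forward_invariance_trajectory
    (m : ℕ) (hm : 1 ≤ m)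
    (α : ℕ → ℝ → ℝ) (ψ : ℕ → ℝ → ℝ)
    (hα_lip : ∀ i, 1 ≤ i → i ≤ m → LocallyLipschitz (α i))
    (hα_mono : ∀ i, 1 ≤ i → i ≤ m → StrictMono (α i))
    (hα0 : ∀ i, 1 ≤ i → i ≤ m → α i 0 = 0)
    (hψ_diff : ∀ i, i ≤ m - 1 → Differentiable ℝ (ψ i))
    (hrec : ∀ i, 1 ≤ i → i ≤ m - 1 → ∀ t, 0 ≤ t →
      ψ i t = deriv (ψ (i - 1)) t + α i (ψ (i - 1) t))
    (h0 : ∀ i, i ≤ m - 1 → ψ i 0 ≥ 0)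
    (hfinal : ∀ t, 0 ≤ t → deriv (ψ (m - 1)) t + α m (ψ (m - 1) t) ≥ 0) :
    ∀ i, i ≤ m - 1 → ∀ t, 0 ≤ t → ψ i t ≥ 0 := by
  have hα_neg : ∀ i, 1 ≤ i → i ≤ m → ∀ x, x < 0 → α i x < 0 := fun i hi him x hx => by
    simpa only [hα0 i hi him] using hα_mono i hi him hx
  intro i hi
  induction hi using Nat.decreasingInduction with
  | self =>
    intro t ht
    refine nonneg_of_deriv_add_comp_nonneg (hα_neg m hm le_rfl) (hψ_diff _ le_rfl)
      (h0 _ le_rfl) hfinal ht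
  | of_succ k hk ih =>
    intro t ht
    refine nonneg_of_deriv_add_comp_nonneg (hα_neg (k + 1) (by omega) (by omega))
      (hψ_diff k hk.le) (h0 k hk.le) (fun s hs => ?_) ht
    have hs' := hrec (k + 1) (by omega) hk s hs
    rw [Nat.add_sub_cancel] at hs'
    exact hs' ▸ ih s hs
end

section
/- Let b: ℝⁿ → ℝ be continuously differentiable and α₁: ℝ → ℝ a locally Lipschitz, strictly increasing function with α₁(0) = 0. Let f_a: ℝⁿ → ℝⁿ and g_a: ℝⁿ → ℝ^{n×q} be continuous, u: [0,∞) → ℝ^q be continuous, let x̄: [0,∞) → ℝⁿ be continuously differentiable with x̄'(t) = f_a(x̄(t)) + g_a(x̄(t))u(t) for all t ≥ 0, let x: [0,∞) → ℝⁿ be continuously differentiable, and set e(t) = x(t) − x̄(t). If b(x(0)) ≥ 0 and for all t ≥ 0 the constraint ∇b(x(t))·f_a(x̄(t)) + ∇b(x(t))·(g_a(x̄(t))u(t)) + ∇b(x(t))·ė(t) + α₁(b(x(t))) ≥ 0 holds, then b(x(t)) ≥ 0 for all t ≥ 0. -/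
/-- A function on `[0, ∞)` that starts nonnegative and has positive derivative wherever it is
negative stays nonnegative. -/
theorem nonneg_of_deriv_pos_of_neg {y y' : ℝ → ℝ} (hy : ∀ t, 0 ≤ t → HasDerivAt y (y' t) t)
    (h0 : 0 ≤ y 0) (hpos : ∀ t, 0 ≤ t → y t < 0 → 0 < y' t) {t : ℝ} (ht : 0 ≤ t) : 0 ≤ y t := by
  refine le_of_forall_pos_le_add fun δ hδ => ?_
  have key : -y t ≤ δ :=
    image_le_of_deriv_right_lt_deriv_boundary (f := fun s => -y s) (f' := fun s => -y' s)
      (B := fun _ => δ) (B' := fun _ => 0) (a := 0) (b := t)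
      (fun s hs => (hy s hs.1).continuousAt.neg.continuousWithinAt)
      (fun s hs => (hy s hs.1).neg.hasDerivWithinAt)
      (by linarith) (fun s => hasDerivAt_const s δ)
      (fun s hs hsδ => neg_lt_zero.mpr (hpos s hs.1 (by linarith)))
      ⟨ht, le_rfl⟩
  linarith

/-- The paper's claim that satisfaction of the CBF constraint (16), written in terms of
the adaptive affine dynamics `x̄' = f_a(x̄) + g_a(x̄)u` (with `g_a` given by its columns
`ga i`, so `g_a(x̄)u = ∑ i, u i • ga i x̄`) and the error state `e = x − x̄` between the
real trajectory `x` and the adaptive trajectory `x̄`, guarantees the relative-degree-one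
safety constraint `b (x t) ≥ 0` for the real unknown dynamics. Here `α₁` is a locally
Lipschitz, strictly increasing function with `α₁ 0 = 0` (class-K extended to ℝ), and
`∇b(x)·v = fderiv ℝ b x v`. -/
theorem cbf_adaptive_dynamics_safety
    (n q : ℕ)
    (b : (Fin n → ℝ) → ℝ) (hb : ContDiff ℝ 1 b)
    (α₁ : ℝ → ℝ) (hα_lip : LocallyLipschitz α₁) (hα_mono : StrictMono α₁)
    (hα0 : α₁ 0 = 0)
    (fa : (Fin n → ℝ) → (Fin n → ℝ)) (ga : Fin q → (Fin n → ℝ) → (Fin n → ℝ))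
    (hfa : Continuous fa) (hga : ∀ i, Continuous (ga i))
    (u : ℝ → Fin q → ℝ) (hu : Continuous u)
    (xbar x : ℝ → Fin n → ℝ)
    (hxbar : ContDiff ℝ 1 xbar) (hx : ContDiff ℝ 1 x)
    (hode : ∀ t, 0 ≤ t → deriv xbar t = fa (xbar t) + ∑ i, u t i • ga i (xbar t))
    (e : ℝ → Fin n → ℝ) (he : e = x - xbar)
    (h0 : b (x 0) ≥ 0)
    (hconstraint : ∀ t, 0 ≤ t →
      fderiv ℝ b (x t) (fa (xbar t))
        + fderiv ℝ b (x t) (∑ i, u t i • ga i (xbar t))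
        + fderiv ℝ b (x t) (deriv e t)
        + α₁ (b (x t)) ≥ 0) :
    ∀ t, 0 ≤ t → b (x t) ≥ 0 := by
  have hxd : Differentiable ℝ x := hx.differentiable one_ne_zero
  have hxbard : Differentiable ℝ xbar := hxbar.differentiable one_ne_zero
  have hbd : Differentiable ℝ b := hb.differentiable one_ne_zero
  intro t ht
  refine nonneg_of_deriv_pos_of_neg (y := fun s => b (x s))
    (y' := fun s => fderiv ℝ b (x s) (deriv x s))
    (fun s _ => (hbd (x s)).hasFDerivAt.comp_hasDerivAt s (hxd s).hasDerivAt) h0 ?_ ht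
  intro s hs hneg
  have hα : α₁ (b (x s)) < 0 := hα0 ▸ hα_mono hneg
  have hxs : deriv x s = fa (xbar s) + ∑ i, u s i • ga i (xbar s) + deriv e s := by
    rw [he, deriv_sub (hxd s) (hxbard s), ← hode s hs]
    abel
  have hc := hconstraint s hs
  rw [← map_add, ← map_add, ← hxs] at hc
  linarith
end
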